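/- arXiv:1008.2780 — 3 statements merged into one kernel-verified Lean document; each statement's English description precedes it below -/
import Mathlib

section
/- The belief axioms imply the axioms of finitely additive probability: Let b be a belief function on (Ω, F) and let B ∈ F be nonempty. Then the map A ↦ b(A|B) on F is a finitely additive probability measure: b(Ω|B) = 1, b(∅|B) = 0, and for all A_1, A_2 ∈ F with A_1 ∩ A_2 = ∅, b(A_1 ∪ A_2|B) = b(A_1|B) + b(A_2|B). -/
/-- An algebra of subsets of `Ω`: nonempty, closed under complement and finite union. -/
structure IsSetAlgebra {Ω : Type*} (F : Set (Set Ω)) : Prop where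
  nonempty : F.Nonempty
  compl_mem : ∀ A ∈ F, Aᶜ ∈ F
  union_mem : ∀ A ∈ F, ∀ B ∈ F, A ∪ B ∈ F

/-- A belief function `b A B` (read `b(A|B)`) on the algebra `F`, satisfying axioms B1–B5
whenever all conditioning events are nonempty. -/
structure IsBelief {Ω : Type*} (F : Set (Set Ω)) (b : Set Ω → Set Ω → ℝ) : Prop where
  b1 : ∀ A ∈ F, ∀ B ∈ F, B.Nonempty → b A B ∈ Set.Icc (0 : ℝ) 1
  b2 : ∀ A ∈ F, ∀ B ∈ F, B.Nonempty → B ⊆ A → b A B = 1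
  b3 : ∀ A ∈ F, ∀ B ∈ F, B.Nonempty → A ∩ B = ∅ → b A B = 0
  b4 : ∀ A ∈ F, ∀ B ∈ F, B.Nonempty → b A B + b Aᶜ B = 1
  b5 : ∀ A ∈ F, ∀ B ∈ F, ∀ C ∈ F, C.Nonempty → (A ∩ C).Nonempty →
        b (A ∩ B) C = b A C * b B (A ∩ C)

/-- **The belief axioms imply the axioms of finitely additive probability.** For any
nonempty `B ∈ F`, the map `A ↦ b(A|B)` is a finitely additive probability measure on `F`:
`b(Ω|B) = 1`, `b(∅|B) = 0`, and `b(A₁ ∪ A₂|B) = b(A₁|B) + b(A₂|B)` whenever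
`A₁ ∩ A₂ = ∅`. -/
theorem belief_finitely_additive {Ω : Type*} [Fintype Ω] [Nonempty Ω]
    (F : Set (Set Ω)) (hF : IsSetAlgebra F)
    (b : Set Ω → Set Ω → ℝ) (hb : IsBelief F b)
    (B : Set Ω) (hB : B ∈ F) (hBne : B.Nonempty) :
    b Set.univ B = 1 ∧ b ∅ B = 0 ∧
      ∀ A₁ ∈ F, ∀ A₂ ∈ F, A₁ ∩ A₂ = ∅ →
        b (A₁ ∪ A₂) B = b A₁ B + b A₂ B := by
  have empty_mem : (∅ : Set Ω) ∈ F := by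
    have h := hF.compl_mem _ (hF.union_mem _ hB _ (hF.compl_mem _ hB))
    rwa [Set.union_compl_self, Set.compl_univ] at h
  have univ_mem : (Set.univ : Set Ω) ∈ F := by
    simpa using hF.compl_mem _ empty_mem
  refine ⟨hb.b2 _ univ_mem _ hB hBne (Set.subset_univ B),
    hb.b3 _ empty_mem _ hB hBne (Set.empty_inter B), fun A₁ h₁ A₂ h₂ hdisj => ?_⟩
  have h₁c := hF.compl_mem _ h₁
  have h₂c := hF.compl_mem _ h₂
  have h_union := hF.union_mem _ h₁ _ h₂
  by_cases hne : (A₁ᶜ ∩ B).Nonempty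
  · have hinter : A₁ᶜ ∩ B ∈ F := by
      have h := hF.compl_mem _ (hF.union_mem _ h₁ _ (hF.compl_mem _ hB))
      rwa [Set.compl_union, compl_compl] at h
    have hA₂ : A₁ᶜ ∩ A₂ = A₂ :=
      Set.inter_eq_right.mpr (Set.disjoint_iff_inter_eq_empty.mpr hdisj).subset_compl_left
    have e₁ := hb.b5 _ h₁c _ h₂ _ hB hBne hne
    have e₂ := hb.b5 _ h₁c _ h₂c _ hB hBne hne
    rw [hA₂] at e₁
    rw [← Set.compl_union] at e₂
    have c₁ := hb.b4 _ h₁ _ hB hBne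
    have c₂ := hb.b4 _ h₂ _ hinter hne
    have c := hb.b4 _ h_union _ hB hBne
    linear_combination c - c₁ - e₁ - e₂ - b A₁ᶜ B * c₂
  · have hsub : B ⊆ A₁ := by
      rw [Set.not_nonempty_iff_eq_empty, Set.inter_comm, ← Set.sdiff_eq] at hne
      exact Set.sdiff_eq_empty.mp hne
    have hA₂B : A₂ ∩ B = ∅ :=
      Set.disjoint_iff_inter_eq_empty.mp
        ((Set.disjoint_iff_inter_eq_empty.mpr hdisj).symm.mono_right hsub)
    rw [hb.b2 _ h_union _ hB hBne (hsub.trans Set.subset_union_left),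
      hb.b2 _ h₁ _ hB hBne hsub, hb.b3 _ h₂ _ hB hBne hA₂B, add_zero]
end

section
/- Existence of the induced belief space: Let (Ω, E, φ) be a causal space with primitive events E = (E_0, E_1, …, E_N), and let F = σ({E_0, E_1, …, E_N}). Then there exists a belief function b on (Ω, F) such that b(A|B) = φ(A|B) for every n ∈ {1, …, N}, every A ∈ 𝔈_n, and every B ∈ 𝔄_{n−1}. -/
open scoped Classical

/-- The algebra generated by a family `G` of subsets of `Ω`: the smallest algebra
containing every member of `G`. -/
def genAlgebra {Ω : Type*} (G : Set (Set Ω)) : Set (Set Ω) :=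
  ⋂₀ {F : Set (Set Ω) | IsSetAlgebra F ∧ G ⊆ F}

/-- The atom set of an algebra `F`: its nonempty minimal elements. -/
def atomsOf {Ω : Type*} (F : Set (Set Ω)) : Set (Set Ω) :=
  {A | A ∈ F ∧ A.Nonempty ∧ ∀ B ∈ F, B.Nonempty → B ⊆ A → B = A}

/-- `algUpTo E k = σ({E_0, E_1, …, E_k})`, the algebra generated by the first `k + 1`
primitive events. -/
def algUpTo {Ω : Type*} (E : ℕ → Set Ω) (k : ℕ) : Set (Set Ω) :=
  genAlgebra (E '' {i | i ≤ k})

/-- `𝔈_n := {E_n, E_nᶜ}`. -/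
def primPair {Ω : Type*} (E : ℕ → Set Ω) (n : ℕ) : Set (Set Ω) :=
  {E n, (E n)ᶜ}

/-- `𝔄_n`: the atom set generated by `σ({E_0, …, E_n})`. -/
def atomSet {Ω : Type*} (E : ℕ → Set Ω) (n : ℕ) : Set (Set Ω) :=
  atomsOf (algUpTo E n)

/-- `E = (E_0, E_1, …, E_N)` is a sequence of primitive events: `E_0 = Ω` and each `E_n`
(`1 ≤ n ≤ N`) is not a member of the algebra generated by the earlier events. -/
structure IsPrimitiveSeq {Ω : Type*} (N : ℕ) (E : ℕ → Set Ω) : Prop where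
  zero_eq : E 0 = Set.univ
  not_mem : ∀ n, 1 ≤ n → n ≤ N → E n ∉ genAlgebra (E '' {i | i < n})

/-- A causal function `φ` over the primitive events `E = (E_0, …, E_N)`: a map
`φ A B` (read `φ(A|B)`) defined on `⋃ₙ (𝔈_n × 𝔄_{n-1})` satisfying axioms C1–C4. -/
structure IsCausal {Ω : Type*} (N : ℕ) (E : ℕ → Set Ω) (φ : Set Ω → Set Ω → ℝ) :
    Prop where
  c1 : ∀ n, 1 ≤ n → n ≤ N → ∀ A ∈ primPair E n, ∀ B ∈ atomSet E (n - 1),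
        φ A B ∈ Set.Icc (0 : ℝ) 1
  c2 : ∀ n, 1 ≤ n → n ≤ N → ∀ A ∈ primPair E n, ∀ B ∈ atomSet E (n - 1),
        B ⊆ A → φ A B = 1
  c3 : ∀ n, 1 ≤ n → n ≤ N → ∀ A ∈ primPair E n, ∀ B ∈ atomSet E (n - 1),
        A ∩ B = ∅ → φ A B = 0
  c4 : ∀ n, 1 ≤ n → n ≤ N → ∀ A ∈ primPair E n, ∀ B ∈ atomSet E (n - 1),
        φ A B + φ Aᶜ B = 1

open Filter Topology

theorem IsSetAlgebra.inter_mem {Ω : Type*} {F : Set (Set Ω)} (hF : IsSetAlgebra F)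
    {A B : Set Ω} (hA : A ∈ F) (hB : B ∈ F) : A ∩ B ∈ F := by
  have h := hF.compl_mem _ (hF.union_mem _ (hF.compl_mem _ hA) _ (hF.compl_mem _ hB))
  rwa [Set.compl_union, compl_compl, compl_compl] at h

/-- The set of points lying in the same events among `E_0, …, E_k` as `x`. -/
def cell {Ω : Type*} (E : ℕ → Set Ω) (k : ℕ) (x : Ω) : Set Ω :=
  {y | ∀ i ≤ k, y ∈ E i ↔ x ∈ E i}

theorem self_mem_cell {Ω : Type*} (E : ℕ → Set Ω) (k : ℕ) (x : Ω) : x ∈ cell E k x :=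
  fun _ _ => Iff.rfl

theorem cell_eq_of_mem {Ω : Type*} {E : ℕ → Set Ω} {k : ℕ} {x y : Ω} (h : y ∈ cell E k x) :
    cell E k y = cell E k x := by
  ext z
  exact ⟨fun hz i hi => (hz i hi).trans (h i hi), fun hz i hi => (hz i hi).trans (h i hi).symm⟩

theorem cell_subset_of_le {Ω : Type*} (E : ℕ → Set Ω) {k l : ℕ} (h : k ≤ l) (x : Ω) :
    cell E l x ⊆ cell E k x :=
  fun _ hy i hi => hy i (hi.trans h)

theorem cell_mem_of_isSetAlgebra {Ω : Type*} {F : Set (Set Ω)} (hF : IsSetAlgebra F)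
    (E : ℕ → Set Ω) (k : ℕ) (hE : ∀ i ≤ k, E i ∈ F) (x : Ω) : cell E k x ∈ F := by
  have side : ∀ i ≤ k, {y | y ∈ E i ↔ x ∈ E i} ∈ F := by
    intro i hi
    by_cases hx : x ∈ E i
    · simpa [hx] using hE i hi
    · simpa [hx, Set.compl_def] using hF.compl_mem _ (hE i hi)
  induction k with
  | zero => simpa [cell] using side 0 le_rfl
  | succ k ih =>
    have hk := ih (fun i hi => hE i (by omega)) (fun i hi => side i (by omega))
    convert hF.inter_mem hk (side (k + 1) le_rfl) using 1
    ext y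
    constructor
    · exact fun hy => ⟨fun i hi => hy i (by omega), hy _ le_rfl⟩
    · rintro ⟨h₁, h₂⟩ i hi
      rcases Nat.le_succ_iff.1 hi with h | rfl
      · exact h₁ i h
      · exact h₂

theorem cell_subset_of_mem_algUpTo {Ω : Type*} {E : ℕ → Set Ω} {k : ℕ} {S : Set Ω}
    (hS : S ∈ algUpTo E k) {x : Ω} (hx : x ∈ S) : cell E k x ⊆ S := by
  have h : S ∈ {T : Set Ω | ∀ x, ∀ y ∈ cell E k x, y ∈ T ↔ x ∈ T} := by
    refine hS _ ⟨⟨⟨Set.univ, by simp⟩, ?_, ?_⟩, ?_⟩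
    · exact fun A hA x y hy => not_congr (hA x y hy)
    · exact fun A hA B hB x y hy => or_congr (hA x y hy) (hB x y hy)
    · rintro _ ⟨i, hi, rfl⟩ x y hy
      exact hy i hi
  exact fun y hy => (h x y hy).2 hx

theorem cell_mem_algUpTo {Ω : Type*} (E : ℕ → Set Ω) (k : ℕ) (x : Ω) :
    cell E k x ∈ algUpTo E k :=
  fun _ hF => cell_mem_of_isSetAlgebra hF.1 E k (fun i hi => hF.2 ⟨i, hi, rfl⟩) x

theorem cell_mem_atomSet {Ω : Type*} (E : ℕ → Set Ω) (k : ℕ) (x : Ω) :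
    cell E k x ∈ atomSet E k := by
  refine ⟨cell_mem_algUpTo E k x, ⟨x, self_mem_cell E k x⟩, ?_⟩
  rintro B hB ⟨y, hy⟩ hsub
  refine hsub.antisymm ?_
  rw [← cell_eq_of_mem (hsub hy)]
  exact cell_subset_of_mem_algUpTo hB hy

theorem exists_eq_cell_of_mem_atomSet {Ω : Type*} {E : ℕ → Set Ω} {k : ℕ} {B : Set Ω}
    (hB : B ∈ atomSet E k) : ∃ x, B = cell E k x := by
  obtain ⟨hmem, ⟨x, hx⟩, hmin⟩ := hB
  exact ⟨x, (hmin _ (cell_mem_algUpTo E k x) ⟨x, self_mem_cell E k x⟩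
    (cell_subset_of_mem_algUpTo hmem hx)).symm⟩

/-- The total weight of the points of `S`. -/
noncomputable def mass {Ω : Type*} [Fintype Ω] (P : Ω → ℝ) (S : Set Ω) : ℝ :=
  ∑ x with x ∈ S, P x

theorem mass_nonneg {Ω : Type*} [Fintype Ω] {P : Ω → ℝ} (hP : ∀ x, 0 < P x) (S : Set Ω) :
    0 ≤ mass P S :=
  Finset.sum_nonneg fun x _ => (hP x).le

theorem mass_pos {Ω : Type*} [Fintype Ω] {P : Ω → ℝ} (hP : ∀ x, 0 < P x) {S : Set Ω}
    (hS : S.Nonempty) : 0 < mass P S :=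
  Finset.sum_pos (fun x _ => hP x) (hS.imp fun x hx => by simpa using hx)

theorem mass_mono {Ω : Type*} [Fintype Ω] {P : Ω → ℝ} (hP : ∀ x, 0 < P x) {S T : Set Ω}
    (h : S ⊆ T) : mass P S ≤ mass P T :=
  Finset.sum_le_sum_of_subset_of_nonneg (fun x hx => by simpa using h (by simpa using hx))
    fun x _ _ => (hP x).le

theorem mass_inter_add_compl {Ω : Type*} [Fintype Ω] (P : Ω → ℝ) (A B : Set Ω) :
    mass P (A ∩ B) + mass P (Aᶜ ∩ B) = mass P B := by
  unfold mass
  rw [← Finset.sum_filter_add_sum_filter_not (Finset.univ.filter (· ∈ B)) (· ∈ A)]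
  simp only [Finset.filter_filter, Set.mem_inter_iff, Set.mem_compl_iff, and_comm]

theorem mass_eq_mul_of_forall {Ω : Type*} [Fintype Ω] {P Q : Ω → ℝ} {S : Set Ω} {c : ℝ}
    (h : ∀ x ∈ S, Q x = c * P x) : mass Q S = c * mass P S := by
  unfold mass
  rw [Finset.mul_sum]
  exact Finset.sum_congr rfl fun x hx => h x (by simpa using hx)

/-- Weights with equal mass on every cell have equal mass on every union of cells. -/
theorem mass_eq_of_cell {Ω : Type*} [Fintype Ω] {E : ℕ → Set Ω} {k : ℕ} {P Q : Ω → ℝ}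
    (h : ∀ x, mass Q (cell E k x) = mass P (cell E k x)) {S : Set Ω}
    (hS : ∀ x ∈ S, cell E k x ⊆ S) : mass Q S = mass P S := by
  unfold mass
  have hmap : ∀ x ∈ Finset.univ.filter (· ∈ S),
      cell E k x ∈ (Finset.univ.filter (· ∈ S)).image (cell E k) :=
    fun x hx => Finset.mem_image_of_mem _ hx
  rw [← Finset.sum_fiberwise_of_maps_to hmap, ← Finset.sum_fiberwise_of_maps_to hmap]
  refine Finset.sum_congr rfl fun C hC => ?_
  obtain ⟨y, hy, rfl⟩ := Finset.mem_image.1 hC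
  have hfilter : ((Finset.univ.filter (· ∈ S)).filter fun x => cell E k x = cell E k y) =
      Finset.univ.filter (· ∈ cell E k y) := by
    ext x
    simp only [Finset.mem_filter, Finset.mem_univ, true_and] at hy ⊢
    exact ⟨fun hx => hx.2 ▸ self_mem_cell E k x, fun hx => ⟨hS y hy hx, cell_eq_of_mem hx⟩⟩
  rw [hfilter]
  exact h y

/-- Rescaling a positive weight on the two sides of an event inside each cell prescribes the
conditional probability of the event given the cell, without changing the mass of the cell. -/
theorem exists_rescaled_weight {Ω : Type*} [Fintype Ω] (E : ℕ → Set Ω) (k : ℕ) (A : Set Ω)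
    {P : Ω → ℝ} (hP : ∀ x, 0 < P x) (q : Set Ω → ℝ)
    (hq : ∀ x, q (cell E k x) ∈ Set.Ioo (0 : ℝ) 1) :
    ∃ Q : Ω → ℝ, (∀ x, 0 < Q x) ∧ (∀ x, mass Q (cell E k x) = mass P (cell E k x)) ∧
      ∀ x, (A ∩ cell E k x).Nonempty → (Aᶜ ∩ cell E k x).Nonempty →
        mass Q (A ∩ cell E k x) = q (cell E k x) * mass Q (cell E k x) := by
  let splits (C : Set Ω) : Prop := (A ∩ C).Nonempty ∧ (Aᶜ ∩ C).Nonempty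
  let r (C : Set Ω) (x : Ω) : ℝ :=
    if splits C then
      if x ∈ A then q C * mass P C / mass P (A ∩ C) else (1 - q C) * mass P C / mass P (Aᶜ ∩ C)
    else 1
  let Q (x : Ω) : ℝ := r (cell E k x) x * P x
  have hQ : ∀ x, ∀ y ∈ cell E k x, Q y = r (cell E k x) y * P y := by
    intro x y hy
    simp only [Q, cell_eq_of_mem hy]
  have key : ∀ x, splits (cell E k x) →
      mass Q (A ∩ cell E k x) = q (cell E k x) * mass P (cell E k x) ∧
      mass Q (Aᶜ ∩ cell E k x) = (1 - q (cell E k x)) * mass P (cell E k x) := by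
    intro x hx
    have h₁ := (mass_pos hP hx.1).ne'
    have h₂ := (mass_pos hP hx.2).ne'
    constructor
    · rw [mass_eq_mul_of_forall (P := P)
        (c := q (cell E k x) * mass P (cell E k x) / mass P (A ∩ cell E k x))]
      · field_simp
      · intro y hy
        rw [hQ x y hy.2]
        simp only [r, if_pos hx, if_pos hy.1]
    · rw [mass_eq_mul_of_forall (P := P)
        (c := (1 - q (cell E k x)) * mass P (cell E k x) / mass P (Aᶜ ∩ cell E k x))]
      · field_simp
      · intro y hy
        rw [hQ x y hy.2]
        simp only [r, if_pos hx, if_neg (show y ∉ A from hy.1)]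
  have hcell : ∀ x, mass Q (cell E k x) = mass P (cell E k x) := by
    intro x
    by_cases hx : splits (cell E k x)
    · rw [← mass_inter_add_compl Q A, (key x hx).1, (key x hx).2]
      ring
    · rw [mass_eq_mul_of_forall (P := P) (c := 1), one_mul]
      intro y hy
      rw [hQ x y hy]
      simp only [r, if_neg hx]
  refine ⟨Q, fun x => mul_pos ?_ (hP x), hcell, fun x h₁ h₂ => ?_⟩
  · simp only [r]
    have hC := mass_pos hP ⟨x, self_mem_cell E k x⟩
    split_ifs with hx hxA
    · exact div_pos (mul_pos (hq x).1 hC) (mass_pos hP hx.1)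
    · exact div_pos (mul_pos (sub_pos.2 (hq x).2) hC) (mass_pos hP hx.2)
    · exact one_pos
  · rw [hcell, (key x ⟨h₁, h₂⟩).1]

theorem exists_weight {Ω : Type*} [Fintype Ω] (E : ℕ → Set Ω) (q : ℕ → Set Ω → ℝ) (N : ℕ)
    (hq : ∀ n < N, ∀ x, q n (cell E n x) ∈ Set.Ioo (0 : ℝ) 1) :
    ∃ P : Ω → ℝ, (∀ x, 0 < P x) ∧ ∀ n < N, ∀ x,
      (E (n + 1) ∩ cell E n x).Nonempty → ((E (n + 1))ᶜ ∩ cell E n x).Nonempty →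
        mass P (E (n + 1) ∩ cell E n x) = q n (cell E n x) * mass P (cell E n x) := by
  induction N with
  | zero => exact ⟨fun _ => 1, fun _ => one_pos, fun n hn => absurd hn (Nat.not_lt_zero n)⟩
  | succ N ih =>
    obtain ⟨P, hP, hPq⟩ := ih fun n hn => hq n (by omega)
    obtain ⟨Q, hQ, hQP, hQq⟩ :=
      exists_rescaled_weight E N (E (N + 1)) hP (q N) (hq N N.lt_succ_self)
    refine ⟨Q, hQ, fun n hn x h₁ h₂ => ?_⟩
    rcases Nat.lt_succ_iff_lt_or_eq.1 hn with h | rfl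
    · have hsub : ∀ y ∈ cell E n x, cell E N y ⊆ cell E n x := by
        intro y hy
        rw [← cell_eq_of_mem hy]
        exact cell_subset_of_le E h.le y
      rw [mass_eq_of_cell hQP hsub, mass_eq_of_cell hQP, hPq n h x h₁ h₂]
      exact fun y hy z hz => ⟨(hz (n + 1) h).2 hy.1, hsub y hy.2 hz⟩
    · exact hQq x h₁ h₂

theorem isBelief_mass_div {Ω : Type*} [Fintype Ω] {P : Ω → ℝ} (hP : ∀ x, 0 < P x) :
    IsBelief Set.univ fun A B : Set Ω => mass P (A ∩ B) / mass P B where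
  b1 A _ B _ hB := ⟨div_nonneg (mass_nonneg hP _) (mass_nonneg hP _),
    div_le_one_of_le₀ (mass_mono hP Set.inter_subset_right) (mass_nonneg hP _)⟩
  b2 A _ B _ hB h := by
    rw [Set.inter_eq_right.2 h, div_self (mass_pos hP hB).ne']
  b3 A _ B _ hB h := by simp [h, mass]
  b4 A _ B _ hB := by
    rw [← add_div, mass_inter_add_compl, div_self (mass_pos hP hB).ne']
  b5 A _ B _ C _ hC hAC := by
    have h₁ := (mass_pos hP hC).ne'
    have h₂ := (mass_pos hP hAC).ne'
    rw [show A ∩ B ∩ C = B ∩ (A ∩ C) by ext; simp only [Set.mem_inter_iff]; tauto]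
    field_simp

theorem IsBelief.mono {Ω : Type*} {F G : Set (Set Ω)} {b : Set Ω → Set Ω → ℝ}
    (hb : IsBelief G b) (h : F ⊆ G) : IsBelief F b where
  b1 A hA B hB := hb.b1 A (h hA) B (h hB)
  b2 A hA B hB := hb.b2 A (h hA) B (h hB)
  b3 A hA B hB := hb.b3 A (h hA) B (h hB)
  b4 A hA B hB := hb.b4 A (h hA) B (h hB)
  b5 A hA B hB C hC := hb.b5 A (h hA) B (h hB) C (h hC)

/-- Any family of belief functions on the full power set converges along any ultrafilter. -/
theorem exists_isBelief_tendsto {Ω ι : Type*} (l : Ultrafilter ι) {b : ι → Set Ω → Set Ω → ℝ}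
    (hb : ∀ i, IsBelief Set.univ (b i)) :
    ∃ c : Set Ω → Set Ω → ℝ, IsBelief Set.univ c ∧
      ∀ A B : Set Ω, B.Nonempty → Tendsto (fun i => b i A B) l (𝓝 (c A B)) := by
  have hlim : ∀ A B : Set Ω, ∃ x : ℝ,
      B.Nonempty → x ∈ Set.Icc (0 : ℝ) 1 ∧ Tendsto (fun i => b i A B) l (𝓝 x) := by
    intro A B
    by_cases hB : B.Nonempty
    · obtain ⟨x, hx, hle⟩ := (isCompact_Icc (a := (0 : ℝ)) (b := 1)).ultrafilter_le_nhds
        (l.map fun i => b i A B) (by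
          rw [Ultrafilter.coe_map, le_principal_iff, mem_map]
          exact Eventually.of_forall fun i => (hb i).b1 A trivial B trivial hB)
      exact ⟨x, fun _ => ⟨hx, hle⟩⟩
    · exact ⟨0, fun h => absurd h hB⟩
  choose c hc using hlim
  refine ⟨c, ⟨fun A _ B _ hB => (hc A B hB).1, ?_, ?_, ?_, ?_⟩, fun A B hB => (hc A B hB).2⟩
  · intro A _ B _ hB h
    refine tendsto_nhds_unique (hc A B hB).2 ?_
    simp only [(hb _).b2 A trivial B trivial hB h, tendsto_const_nhds]
  · intro A _ B _ hB h
    refine tendsto_nhds_unique (hc A B hB).2 ?_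
    simp only [(hb _).b3 A trivial B trivial hB h, tendsto_const_nhds]
  · intro A _ B _ hB
    refine tendsto_nhds_unique ((hc A B hB).2.add (hc Aᶜ B hB).2) ?_
    simp only [(hb _).b4 A trivial B trivial hB, tendsto_const_nhds]
  · intro A _ B _ C _ hC hAC
    refine tendsto_nhds_unique (hc (A ∩ B) C hC).2 ?_
    simp only [(hb _).b5 A trivial B trivial C trivial hC hAC]
    exact (hc A C hC).2.mul (hc B (A ∩ C) hAC).2

/-- **Existence of the induced belief space.** Let `(Ω, E, φ)` be a causal space with
`E = (E_0, …, E_N)` and `F = σ({E_0, …, E_N})`. Then there exists a belief function `b`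
on `(Ω, F)` agreeing with `φ` on `⋃ₙ (𝔈_n × 𝔄_{n-1})`. -/
theorem induced_belief_exists {Ω : Type*} [Fintype Ω] [Nonempty Ω]
    (N : ℕ) (E : ℕ → Set Ω) (hE : IsPrimitiveSeq N E)
    (φ : Set Ω → Set Ω → ℝ) (hφ : IsCausal N E φ) :
    ∃ b : Set Ω → Set Ω → ℝ, IsBelief (algUpTo E N) b ∧
      ∀ n, 1 ≤ n → n ≤ N → ∀ A ∈ primPair E n, ∀ B ∈ atomSet E (n - 1),
        b A B = φ A B := by
  let ε (j : ℕ) : ℝ := 1 / ((j : ℝ) + 1)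
  have hε : ∀ j, 0 < ε j ∧ ε j ≤ 1 := fun j => ⟨Nat.one_div_pos_of_nat, by
    simpa [ε] using Nat.one_div_le_one_div (α := ℝ) (Nat.zero_le j)⟩
  let q (j n : ℕ) (B : Set Ω) : ℝ := (1 - ε j) * φ (E (n + 1)) B + ε j / 2
  have hq : ∀ j, ∀ n < N, ∀ x, q j n (cell E n x) ∈ Set.Ioo (0 : ℝ) 1 := by
    intro j n hn x
    obtain ⟨h₀, h₁⟩ := hφ.c1 (n + 1) (by omega) hn (E (n + 1)) (Or.inl rfl) _
      (cell_mem_atomSet E n x)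
    obtain ⟨hε₀, hε₁⟩ := hε j
    constructor <;> simp only [q] <;> nlinarith
  choose P hP hPq using fun j => exists_weight E (q j) N (hq j)
  obtain ⟨b, hb, hlim⟩ := exists_isBelief_tendsto (hyperfilter ℕ) fun j => isBelief_mass_div (hP j)
  have hbE : ∀ n < N, ∀ x, b (E (n + 1)) (cell E n x) = φ (E (n + 1)) (cell E n x) := by
    intro n hn x
    have hne : (cell E n x).Nonempty := ⟨x, self_mem_cell E n x⟩
    have hatom : cell E n x ∈ atomSet E (n + 1 - 1) := cell_mem_atomSet E n x
    rcases Set.eq_empty_or_nonempty (E (n + 1) ∩ cell E n x) with h₁ | h₁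
    · rw [hb.b3 _ trivial _ trivial hne h₁,
        hφ.c3 (n + 1) (by omega) hn _ (Or.inl rfl) _ hatom h₁]
    rcases Set.eq_empty_or_nonempty ((E (n + 1))ᶜ ∩ cell E n x) with h₂ | h₂
    · have hsub : cell E n x ⊆ E (n + 1) := fun y hy => by
        by_contra hyE
        exact (h₂ ▸ (⟨hyE, hy⟩ : y ∈ (E (n + 1))ᶜ ∩ cell E n x) : y ∈ (∅ : Set Ω))
      rw [hb.b2 _ trivial _ trivial hne hsub,
        hφ.c2 (n + 1) (by omega) hn _ (Or.inl rfl) _ hatom hsub]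
    refine tendsto_nhds_unique (hlim (E (n + 1)) _ hne) ?_
    have hratio : ∀ j, mass (P j) (E (n + 1) ∩ cell E n x) / mass (P j) (cell E n x) =
        q j n (cell E n x) := fun j => by
      rw [hPq j n hn x h₁ h₂, mul_div_cancel_right₀ _ (mass_pos (hP j) hne).ne']
    simp only [hratio, q]
    have hε_lim : Tendsto ε (hyperfilter ℕ) (𝓝 0) :=
      tendsto_one_div_add_atTop_nhds_zero_nat.mono_left Nat.hyperfilter_le_atTop
    simpa using ((hε_lim.const_sub 1).mul_const (φ (E (n + 1)) (cell E n x))).add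
      (hε_lim.div_const 2)
  refine ⟨b, hb.mono (Set.subset_univ _), fun n hn hnN A hA B hB => ?_⟩
  obtain ⟨m, rfl⟩ : ∃ m, n = m + 1 := ⟨n - 1, by omega⟩
  obtain ⟨x, hx⟩ := exists_eq_cell_of_mem_atomSet hB
  rw [Nat.add_sub_cancel] at hx
  have hE_eq := hbE m hnN x
  rw [← hx] at hE_eq
  rcases hA with rfl | rfl
  · exact hE_eq
  · have h₁ := hb.b4 (E (m + 1)) trivial B trivial (hx ▸ ⟨x, self_mem_cell E m x⟩)
    have h₂ := hφ.c4 (m + 1) hn hnN (E (m + 1)) (Or.inl rfl) B hB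
    linarith
end

section
/- An intervention of a causal space is again a causal space: Let (Ω, E, φ) be a causal space and let A ∈ 𝔈_m for some m ∈ {1, …, N}. Define φ' on ⋃_{n=1}^{N} (𝔈_n × 𝔄_{n−1}) by: φ'(B|C) = 1 if A = B and B ∩ C ∉ {∅, C}; φ'(B|C) = 0 if A = Bᶜ and B ∩ C ∉ {∅, C}; and φ'(B|C) = φ(B|C) otherwise. Then φ' satisfies axioms C1–C4, i.e. (Ω, E, φ') is a causal space. -/
open scoped Classical

theorem compl_inter_eq_empty_iff_inter_eq_right {α : Type*} (B C : Set α) :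
    Bᶜ ∩ C = ∅ ↔ B ∩ C = C := by
  rw [Set.inter_eq_right, ← Set.disjoint_iff_inter_eq_empty, Set.disjoint_compl_left_iff_subset]

theorem compl_inter_eq_right_iff_inter_eq_empty {α : Type*} (B C : Set α) :
    Bᶜ ∩ C = C ↔ B ∩ C = ∅ := by
  rw [← compl_inter_eq_empty_iff_inter_eq_right, compl_compl]

/-- **An intervention of a causal space is again a causal space.** Let `(Ω, E, φ)` be a
causal space and `A ∈ 𝔈_m` for some `m ∈ {1, …, N}`. The intervened function `φ'`,
given by `φ'(B|C) = 1` if `A = B` and `B ∩ C ∉ {∅, C}`, `φ'(B|C) = 0` if `A = Bᶜ` and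
`B ∩ C ∉ {∅, C}`, and `φ'(B|C) = φ(B|C)` otherwise, satisfies axioms C1–C4, i.e.
`(Ω, E, φ')` is a causal space. -/
theorem intervention_is_causal {Ω : Type*} [Fintype Ω] [Nonempty Ω]
    (N : ℕ) (E : ℕ → Set Ω) (hE : IsPrimitiveSeq N E)
    (φ : Set Ω → Set Ω → ℝ) (hφ : IsCausal N E φ)
    (m : ℕ) (hm1 : 1 ≤ m) (hmN : m ≤ N) (A : Set Ω) (hA : A ∈ primPair E m)
    (φ' : Set Ω → Set Ω → ℝ)
    (hφ' : ∀ B C : Set Ω, φ' B C =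
      if A = B ∧ B ∩ C ≠ ∅ ∧ B ∩ C ≠ C then 1
      else if A = Bᶜ ∧ B ∩ C ≠ ∅ ∧ B ∩ C ≠ C then 0
      else φ B C) :
    IsCausal N E φ' := by
  refine ⟨?_, ?_, ?_, ?_⟩
  · intro n h1 hN B hB C hC
    rw [hφ']
    split_ifs
    · simp
    · simp
    · exact hφ.c1 n h1 hN B hB C hC
  · intro n h1 hN B hB C hC hCB
    have h : B ∩ C = C := Set.inter_eq_right.mpr hCB
    simpa [hφ', h] using hφ.c2 n h1 hN B hB C hC hCB
  · intro n h1 hN B hB C hC h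
    simpa [hφ', h] using hφ.c3 n h1 hN B hB C hC h
  · intro n h1 hN B hB C hC
    have h4 := hφ.c4 n h1 hN B hB C hC
    have hne : B ≠ Bᶜ := ne_compl_self
    simp only [hφ', compl_compl, ne_eq, compl_inter_eq_empty_iff_inter_eq_right,
      compl_inter_eq_right_iff_inter_eq_empty]
    grind
end
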